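/- For every integer d ≥ 1 there exists a set V ⊆ {-1,+1}^d such that any two distinct elements α, β ∈ V differ in at least d/4 coordinates (i.e., the Hamming distance between α and β is at least d/4), and the cardinality of V satisfies |V| ≥ (2/√e)^{d/2}. -/

import Mathlib

/-- The cube `{-1, 1}^d`, as a finite set of integer vectors. -/
def signCube (d : ℕ) : Finset (Fin d → ℤ) :=
  Fintype.piFinset fun _ => {1, -1}

theorem mem_signCube {d : ℕ} {x : Fin d → ℤ} :
    x ∈ signCube d ↔ ∀ i, x i = 1 ∨ x i = -1 := by
  simp [signCube]

theorem card_signCube (d : ℕ) : (signCube d).card = 2 ^ d := by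
  simp [signCube, Fintype.card_piFinset]

/-- The generating function of the Hamming distances to a fixed vertex of the cube. -/
theorem sum_signCube_pow_hammingDist {d : ℕ} {v : Fin d → ℤ} (hv : v ∈ signCube d) (t : ℝ) :
    ∑ x ∈ signCube d, t ^ hammingDist x v = (1 + t) ^ d := by
  have hprod (x : Fin d → ℤ) :
      t ^ hammingDist x v = ∏ i, if x i ≠ v i then t else 1 := by
    simp [hammingDist, Finset.prod_ite]
  simp_rw [hprod]
  rw [signCube, Finset.sum_prod_piFinset {1, -1}
    (fun i (a : ℤ) => if a ≠ v i then t else 1)]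
  have hsum (i : Fin d) : ∑ a ∈ ({1, -1} : Finset ℤ), (if a ≠ v i then t else 1) = 1 + t := by
    rw [Finset.sum_pair (by norm_num)]
    rcases mem_signCube.1 hv i with h | h <;> simp [h, add_comm]
  simp only [hsum, Finset.prod_const, Finset.card_univ, Fintype.card_fin]

/-- A finite set contains a subset that is `r`-separated and `r`-covering for a symmetric
function. -/
theorem exists_separated_covering {X : Type*} [DecidableEq X] (Q : Finset X) (D : X → X → ℝ)
    (hD : ∀ x y, D x y = D y x) (r : ℝ) :
    ∃ V ⊆ Q, (∀ x ∈ V, ∀ y ∈ V, x ≠ y → r ≤ D x y) ∧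
      ∀ x ∈ Q, x ∈ V ∨ ∃ v ∈ V, D x v < r := by
  classical
  obtain ⟨V, hV, hmax⟩ := Finset.exists_max_image
    (Q.powerset.filter fun V => ∀ x ∈ V, ∀ y ∈ V, x ≠ y → r ≤ D x y) Finset.card
    ⟨∅, by simp⟩
  simp only [Finset.mem_filter, Finset.mem_powerset] at hV hmax
  refine ⟨V, hV.1, hV.2, fun x hx => ?_⟩
  by_contra! h
  obtain ⟨hxV, hfar⟩ := h
  have hle := hmax (insert x V) ⟨Finset.insert_subset hx hV.1, by
    intro a ha b hb hab
    rcases Finset.mem_insert.1 ha with rfl | haV <;> rcases Finset.mem_insert.1 hb with rfl | hbV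
    · exact absurd rfl hab
    · exact hfar b hbV
    · exact hD a b ▸ hfar a haV
    · exact hV.2 a haV b hbV hab⟩
  rw [Finset.card_insert_of_notMem hxV] at hle
  omega

theorem two_div_sqrt_exp_rpow_mul_le (d : ℕ) :
    (2 / Real.sqrt (Real.exp 1)) ^ ((d : ℝ) / 2) * (4 / 3 : ℝ) ^ d ≤
      2 ^ d * (1 / 3 : ℝ) ^ ((d : ℝ) / 4) := by
  have he : (2.7 : ℝ) < Real.exp 1 := by linarith [Real.exp_one_gt_d9]
  have hs : 0 < Real.sqrt (Real.exp 1) := Real.sqrt_pos.2 (Real.exp_pos 1)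
  refine le_of_pow_le_pow_left₀ (n := 4) (by norm_num) (by positivity) ?_
  have h₁ : ((2 / Real.sqrt (Real.exp 1)) ^ ((d : ℝ) / 2)) ^ 4 = (4 / Real.exp 1) ^ d := by
    rw [← Real.rpow_natCast, ← Real.rpow_mul (by positivity),
      show (d : ℝ) / 2 * (4 : ℕ) = ((2 * d : ℕ) : ℝ) by push_cast; ring, Real.rpow_natCast,
      pow_mul, div_pow, Real.sq_sqrt (Real.exp_pos 1).le]
    norm_num
  have h₂ : ((1 / 3 : ℝ) ^ ((d : ℝ) / 4)) ^ 4 = (1 / 3) ^ d := by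
    rw [← Real.rpow_natCast, ← Real.rpow_mul (by positivity),
      show (d : ℝ) / 4 * (4 : ℕ) = (d : ℝ) by push_cast; ring, Real.rpow_natCast]
  rw [mul_pow, mul_pow, h₁, h₂, pow_right_comm, pow_right_comm 2, ← mul_pow, ← mul_pow]
  refine pow_le_pow_left₀ (by positivity) ?_ d
  rw [div_mul_eq_mul_div, div_le_iff₀ (Real.exp_pos 1)]
  norm_num
  linarith

theorem stmt_0 (d : ℕ) (hd : 1 ≤ d) :
    ∃ V : Finset (Fin d → ℤ),
      (∀ α ∈ V, ∀ i, α i = 1 ∨ α i = -1) ∧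
      (∀ α ∈ V, ∀ β ∈ V, α ≠ β →
        (d : ℝ) / 4 ≤ ((Finset.univ.filter fun i => α i ≠ β i).card : ℝ)) ∧
      (2 / Real.sqrt (Real.exp 1)) ^ ((d : ℝ) / 2) ≤ (V.card : ℝ) := by
  obtain ⟨V, hVQ, hsep, hcov⟩ := exists_separated_covering (signCube d)
    (fun x y => (hammingDist x y : ℝ)) (fun x y => by rw [hammingDist_comm]) ((d : ℝ) / 4)
  refine ⟨V, fun α hα => mem_signCube.1 (hVQ hα), hsep, ?_⟩
  have hclose : ∀ x ∈ signCube d, ∃ v ∈ V, (hammingDist x v : ℝ) ≤ (d : ℝ) / 4 := by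
    intro x hx
    rcases hcov x hx with h | ⟨v, hv, h⟩
    · exact ⟨x, h, by simp only [hammingDist_self, Nat.cast_zero]; positivity⟩
    · exact ⟨v, hv, h.le⟩
  have hlower : ∀ x ∈ signCube d,
      (1 / 3 : ℝ) ^ ((d : ℝ) / 4) ≤ ∑ v ∈ V, (1 / 3 : ℝ) ^ hammingDist x v := by
    intro x hx
    obtain ⟨v, hv, h⟩ := hclose x hx
    refine le_trans ?_ (Finset.single_le_sum
      (f := fun v => (1 / 3 : ℝ) ^ hammingDist x v) (fun _ _ => by positivity) hv)
    rw [← Real.rpow_natCast]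
    exact Real.rpow_le_rpow_of_exponent_ge (by norm_num) (by norm_num) h
  have hcount : 2 ^ d * (1 / 3 : ℝ) ^ ((d : ℝ) / 4) ≤ V.card * (4 / 3 : ℝ) ^ d := by
    calc 2 ^ d * (1 / 3 : ℝ) ^ ((d : ℝ) / 4)
        = ∑ x ∈ signCube d, (1 / 3 : ℝ) ^ ((d : ℝ) / 4) := by simp [card_signCube]
      _ ≤ ∑ x ∈ signCube d, ∑ v ∈ V, (1 / 3 : ℝ) ^ hammingDist x v := Finset.sum_le_sum hlower
      _ = ∑ v ∈ V, ∑ x ∈ signCube d, (1 / 3 : ℝ) ^ hammingDist x v := Finset.sum_comm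
      _ = ∑ v ∈ V, (4 / 3 : ℝ) ^ d := Finset.sum_congr rfl fun v hv => by
          rw [sum_signCube_pow_hammingDist (hVQ hv)]; norm_num
      _ = V.card * (4 / 3 : ℝ) ^ d := by simp
  exact le_of_mul_le_mul_right ((two_div_sqrt_exp_rpow_mul_le d).trans hcount) (by positivity)
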